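/- Let m ≥ 1 and j ≥ 1 be integers, let ν > m be real, let σ > 0 and 1 < q < ∞. Then there exists a constant c > 0, depending only on m, j, ν, σ, q (in particular independent of R), such that for every R > 0 and every finite nonnegative Borel measure μ on ℝ^m with support contained in the closed ball {|z| ≤ R} one has (1/c) ∫₀^R F^R_{ν,m}[μ](τ) h_{σ,j}(τ) dτ ≤ I^{m,j}_{ν,σ}(μ; R) ≤ c ∫₀^R F^R_{ν,m}[μ](τ) h_{σ,j}(τ) dτ. -/

import Mathlib

open MeasureTheory Set
open scoped ENNReal

/-- The inner kernel `∫ (τ² + |y − z|²)^{−ν/2} dμ(z)`. -/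
noncomputable def innerKernel (m : ℕ) (ν : ℝ) (μ : Measure (EuclideanSpace ℝ (Fin m)))
    (τ : ℝ) (y : EuclideanSpace ℝ (Fin m)) : ℝ≥0∞ :=
  ∫⁻ z, ENNReal.ofReal ((τ ^ 2 + ‖y - z‖ ^ 2) ^ (-ν / 2)) ∂μ

/-- `F^R_{ν,m}[μ](τ)`, the truncated version of `F_{ν,m}[μ]`. -/
noncomputable def FnmR (m : ℕ) (ν q R : ℝ) (μ : Measure (EuclideanSpace ℝ (Fin m)))
    (τ : ℝ) : ℝ≥0∞ :=
  ∫⁻ y in Metric.ball (0 : EuclideanSpace ℝ (Fin m)) R, innerKernel m ν μ τ y ^ q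

/-- The weight `h_{σ,j}`. -/
noncomputable def hWeight (σ q : ℝ) (j : ℕ) (τ : ℝ) : ℝ :=
  if 2 ≤ j then τ ^ ((σ + 1) * q + j - 2) / (1 + τ) ^ ((σ + 1) * q)
  else Real.exp (-τ) * τ ^ ((σ + 1) * q - 1)

/-- The truncated half-space integral `I^{m,j}_{ν,σ}(μ; R)`. -/
noncomputable def ImjR (m j : ℕ) (ν σ q R : ℝ)
    (μ : Measure (EuclideanSpace ℝ (Fin m))) : ℝ≥0∞ :=
  if 2 ≤ j then
    ∫⁻ p : ℝ × EuclideanSpace ℝ (Fin (j - 1)) in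
        {p | 0 < p.1 ∧ p.1 ^ 2 + ‖p.2‖ ^ 2 < R ^ 2},
      FnmR m ν q R μ (Real.sqrt (p.1 ^ 2 + ‖p.2‖ ^ 2)) *
        ENNReal.ofReal (Real.exp (-p.1) * p.1 ^ ((σ + 1) * q - 1))
  else
    ∫⁻ t in Ioo (0 : ℝ) R, FnmR m ν q R μ t *
      ENNReal.ofReal (Real.exp (-t) * t ^ ((σ + 1) * q - 1))

open Measure in
/-- Polar coordinates for the lower Lebesgue integral of a radial function. -/
theorem lintegral_fun_norm {E : Type*} [NormedAddCommGroup E] [NormedSpace ℝ E]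
    [FiniteDimensional ℝ E] [Nontrivial E] [MeasurableSpace E] [BorelSpace E]
    (μ : Measure E) [μ.IsAddHaarMeasure] {f : ℝ → ℝ≥0∞} (hf : Measurable f) :
    ∫⁻ x, f ‖x‖ ∂μ = μ.toSphere univ *
      ∫⁻ r in Ioi (0 : ℝ), ENNReal.ofReal (r ^ (Module.finrank ℝ E - 1)) * f r := by
  calc
    ∫⁻ x, f ‖x‖ ∂μ = ∫⁻ x : ({(0)}ᶜ : Set E), f ‖x.1‖ ∂(μ.comap (↑)) := by
      rw [lintegral_subtype_comap (measurableSet_singleton _).compl fun x ↦ f ‖x‖,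
        restrict_compl_singleton]
    _ = ∫⁻ x, f x.2 ∂(μ.toSphere.prod (.volumeIoiPow (Module.finrank ℝ E - 1))) := by
      simpa using μ.measurePreserving_homeomorphUnitSphereProd.lintegral_comp_emb
        (Homeomorph.measurableEmbedding _) (f ∘ Subtype.val ∘ Prod.snd)
    _ = μ.toSphere univ *
        ∫⁻ r : Ioi (0 : ℝ), f r ∂(.volumeIoiPow (Module.finrank ℝ E - 1)) := by
      have hm : Measurable fun r : Ioi (0 : ℝ) ↦ f r := hf.comp measurable_subtype_coe
      have hm2 : Measurable fun x : Metric.sphere (0 : E) 1 × Ioi (0 : ℝ) ↦ f x.2 :=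
        hm.comp measurable_snd
      rw [lintegral_prod _ hm2.aemeasurable]
      simp only [lintegral_const, mul_comm]
    _ = _ := by
      have hm : Measurable fun r : Ioi (0 : ℝ) ↦ f r := hf.comp measurable_subtype_coe
      rw [Measure.volumeIoiPow, lintegral_withDensity_eq_lintegral_mul _ (by fun_prop) hm]
      congr 1
      exact lintegral_subtype_comap measurableSet_Ioi
        fun r : ℝ ↦ ENNReal.ofReal (r ^ (Module.finrank ℝ E - 1)) * f r

/-- Polar coordinates in the open first quadrant. -/
theorem setLIntegral_quadrant_eq_polar {H : ℝ × ℝ → ℝ≥0∞} (hH : Measurable H) :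
    ∫⁻ p in Ioi (0 : ℝ) ×ˢ Ioi (0 : ℝ), H p =
      ∫⁻ ρ in Ioi (0 : ℝ), ∫⁻ θ in Ioo (0 : ℝ) (Real.pi / 2),
        ENNReal.ofReal ρ * H (ρ * Real.cos θ, ρ * Real.sin θ) := by
  have hQ : MeasurableSet (Ioi (0 : ℝ) ×ˢ Ioi (0 : ℝ)) := measurableSet_Ioi.prod measurableSet_Ioi
  have hmeas : Measurable fun p : ℝ × ℝ ↦ ENNReal.ofReal p.1 *
      (Ioi (0 : ℝ) ×ˢ Ioi (0 : ℝ)).indicator H (p.1 * Real.cos p.2, p.1 * Real.sin p.2) :=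
    (by fun_prop : Measurable fun p : ℝ × ℝ ↦ ENNReal.ofReal p.1).mul
      ((hH.indicator hQ).comp (by fun_prop))
  rw [← lintegral_indicator hQ, ← lintegral_comp_polarCoord_symm]
  change ∫⁻ p in Ioi (0 : ℝ) ×ˢ Ioo (-Real.pi) Real.pi, ENNReal.ofReal p.1 *
      (Ioi (0 : ℝ) ×ˢ Ioi (0 : ℝ)).indicator H (p.1 * Real.cos p.2, p.1 * Real.sin p.2) = _
  rw [Measure.volume_eq_prod, setLIntegral_prod _ hmeas.aemeasurable]
  refine setLIntegral_congr_fun measurableSet_Ioi fun ρ hρ ↦ ?_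
  have hρ : 0 < ρ := hρ
  rw [← lintegral_indicator measurableSet_Ioo, ← lintegral_indicator measurableSet_Ioo]
  congr 1
  ext θ
  have hpi := Real.pi_pos
  by_cases h : θ ∈ Ioo (0 : ℝ) (Real.pi / 2)
  · have h2 : θ ∈ Ioo (-Real.pi) Real.pi := ⟨by linarith [h.1], by linarith [h.2]⟩
    have hc := Real.cos_pos_of_mem_Ioo ⟨by linarith [h.1], h.2⟩
    have hs := Real.sin_pos_of_mem_Ioo ⟨h.1, h2.2⟩
    rw [indicator_of_mem h, indicator_of_mem h2,
      indicator_of_mem (mk_mem_prod (mem_Ioi.2 (mul_pos hρ hc)) (mem_Ioi.2 (mul_pos hρ hs)))]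
  · rw [indicator_of_notMem h]
    by_cases h2 : θ ∈ Ioo (-Real.pi) Real.pi
    · rw [indicator_of_mem h2, indicator_of_notMem, mul_zero]
      rintro ⟨hc, hs⟩
      have hc : 0 < Real.cos θ := pos_of_mul_pos_right hc hρ.le
      have hs : 0 < Real.sin θ := pos_of_mul_pos_right hs hρ.le
      refine h ⟨?_, ?_⟩
      · by_contra! h0
        exact hs.not_ge (Real.sin_nonpos_of_nonpos_of_neg_pi_le h0 h2.1.le)
      · by_contra! h0
        exact hc.not_ge (Real.cos_nonpos_of_pi_div_two_le_of_le h0 (by linarith [h2.2]))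
    · rw [indicator_of_notMem h2]

/-- Polar coordinates in the half-space `{(t, x) | 0 < t}` of `ℝ × E`, for functions of `t`
and `‖x‖`. -/
theorem setLIntegral_halfSpace_eq_polar {E : Type*} [NormedAddCommGroup E] [NormedSpace ℝ E]
    [FiniteDimensional ℝ E] [Nontrivial E] [MeasureSpace E] [BorelSpace E]
    [(volume : Measure E).IsAddHaarMeasure] {g : ℝ → ℝ → ℝ≥0∞}
    (hg : Measurable (Function.uncurry g)) :
    ∫⁻ p : ℝ × E in {p | 0 < p.1}, g p.1 ‖p.2‖ = (volume : Measure E).toSphere univ *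
      ∫⁻ ρ in Ioi (0 : ℝ), ∫⁻ θ in Ioo (0 : ℝ) (Real.pi / 2), ENNReal.ofReal ρ *
        (ENNReal.ofReal ((ρ * Real.cos θ) ^ (Module.finrank ℝ E - 1)) *
          g (ρ * Real.sin θ) (ρ * Real.cos θ)) := by
  have hset : {p : ℝ × E | 0 < p.1} = Ioi (0 : ℝ) ×ˢ univ := by ext; simp
  have hH : Measurable fun p : ℝ × ℝ ↦
      ENNReal.ofReal (p.1 ^ (Module.finrank ℝ E - 1)) * g p.2 p.1 :=
    Measurable.mul (by fun_prop) (hg.comp measurable_swap)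
  have hH' : Measurable fun p : ℝ × ℝ ↦
      ENNReal.ofReal (p.2 ^ (Module.finrank ℝ E - 1)) * g p.1 p.2 := hH.comp measurable_swap
  have hgn : Measurable fun p : ℝ × E ↦ g p.1 ‖p.2‖ :=
    hg.comp (measurable_fst.prodMk measurable_snd.norm)
  rw [← setLIntegral_quadrant_eq_polar hH, hset, Measure.volume_eq_prod, Measure.volume_eq_prod,
    setLIntegral_prod _ hgn.aemeasurable,
    setLIntegral_prod_symm _ hH.aemeasurable, ← lintegral_const_mul]
  · refine setLIntegral_congr_fun measurableSet_Ioi fun t _ ↦ ?_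
    rw [Measure.restrict_univ]
    exact lintegral_fun_norm volume (f := g t) (hg.comp measurable_prodMk_left)
  · exact hH'.lintegral_prod_right'

/-- The angular integral obtained when `e^{-y₁} y₁^{a-1}` is integrated over the half-sphere of
radius `ρ`. -/
noncomputable def angularIntegral (k : ℕ) (a ρ : ℝ) : ℝ≥0∞ :=
  ∫⁻ θ in Ioo (0 : ℝ) (Real.pi / 2), ENNReal.ofReal
    (Real.cos θ ^ k * (Real.exp (-(ρ * Real.sin θ)) * Real.sin θ ^ (a - 1)))

theorem le_angularIntegral (k : ℕ) {a ρ : ℝ} (ha : 1 ≤ a) (hρ : 0 ≤ ρ) :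
    ENNReal.ofReal (Real.cos 1 ^ k * (Real.exp (-1) * (1 / Real.pi) ^ (a - 1)) / 2 *
      (1 / (1 + ρ) ^ a)) ≤ angularIntegral k a ρ := by
  have hpi := Real.pi_gt_three
  have h1ρ : 0 < 1 + ρ := by linarith
  set u : ℝ := 1 / (1 + ρ) with hu
  have hu0 : 0 < u := by positivity
  have hu1 : u ≤ 1 := by rw [hu, div_le_one h1ρ]; linarith
  have hρu : ρ * u ≤ 1 := by rw [hu, mul_one_div, div_le_one h1ρ]; linarith
  have hcos1 : 0 < Real.cos 1 := Real.cos_one_pos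
  set A : ℝ := Real.cos 1 ^ k * (Real.exp (-1) * (u / Real.pi) ^ (a - 1)) with hA
  have hval : Real.cos 1 ^ k * (Real.exp (-1) * (1 / Real.pi) ^ (a - 1)) / 2 *
      (1 / (1 + ρ) ^ a) = A * (u - u / 2) := by
    have e1 : 1 / (1 + ρ) ^ a = u ^ (a - 1) * u := by
      rw [← Real.rpow_add_one hu0.ne', sub_add_cancel, hu, Real.div_rpow zero_le_one h1ρ.le,
        Real.one_rpow]
    have e2 : (u / Real.pi) ^ (a - 1) = (1 / Real.pi) ^ (a - 1) * u ^ (a - 1) := by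
      rw [← Real.mul_rpow (by positivity) hu0.le]; congr 1; ring
    rw [e1, hA, e2]; ring
  have hsub : Ioo (u / 2) u ⊆ Ioo (0 : ℝ) (Real.pi / 2) := fun θ h ↦
    ⟨by linarith [h.1], by linarith [h.2]⟩
  calc
    _ = ∫⁻ _ in Ioo (u / 2) u, ENNReal.ofReal A := by
      rw [hval, setLIntegral_const, Real.volume_Ioo, ENNReal.ofReal_mul (by positivity)]
    _ ≤ ∫⁻ θ in Ioo (u / 2) u, ENNReal.ofReal
        (Real.cos θ ^ k * (Real.exp (-(ρ * Real.sin θ)) * Real.sin θ ^ (a - 1))) := by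
      refine setLIntegral_mono' measurableSet_Ioo fun θ h ↦ ENNReal.ofReal_le_ofReal ?_
      have h0 : 0 < θ := (hsub h).1
      have hc : Real.cos 1 ≤ Real.cos θ :=
        Real.cos_le_cos_of_nonneg_of_le_pi h0.le (by linarith) (by linarith [h.2])
      have hs : Real.sin θ ≤ u := (Real.sin_le h0.le).trans h.2.le
      have hs' : u / Real.pi ≤ Real.sin θ := by
        refine le_trans ?_ (Real.mul_le_sin h0.le (hsub h).2.le)
        calc u / Real.pi = 2 / Real.pi * (u / 2) := by ring
          _ ≤ 2 / Real.pi * θ := by gcongr; exact h.1.le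
      have he : ρ * Real.sin θ ≤ 1 := (mul_le_mul_of_nonneg_left hs hρ).trans hρu
      have ha' : 0 ≤ a - 1 := by linarith
      have hc0 : 0 ≤ Real.cos θ := hcos1.le.trans hc
      rw [hA]
      gcongr
    _ ≤ _ := lintegral_mono_set hsub

theorem angularIntegral_le (k : ℕ) {a ρ : ℝ} (ha : 1 ≤ a) (hρ : 0 ≤ ρ) :
    angularIntegral k a ρ ≤ ENNReal.ofReal
      (Real.exp 1 * ((Real.pi / 2) ^ a * Real.Gamma a) * (1 / (1 + ρ) ^ a)) := by
  have hpi := Real.pi_gt_three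
  have h1ρ : 0 < 1 + ρ := by linarith
  have ha0 : 0 < a := by linarith
  set b : ℝ := 2 / Real.pi * (1 + ρ) with hb
  have hb0 : 0 < b := by positivity
  have hint := Real.integral_rpow_mul_exp_neg_mul_Ioi ha0 hb0
  have hpos : 0 < (1 / b) ^ a * Real.Gamma a :=
    mul_pos (by positivity) (Real.Gamma_pos_of_pos ha0)
  have hintegrable : IntegrableOn (fun t : ℝ ↦ t ^ (a - 1) * Real.exp (-(b * t))) (Ioi 0) :=
    Integrable.of_integral_ne_zero (by rw [hint]; exact hpos.ne')
  have hval : Real.exp 1 * ((Real.pi / 2) ^ a * Real.Gamma a) * (1 / (1 + ρ) ^ a) =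
      Real.exp 1 * ((1 / b) ^ a * Real.Gamma a) := by
    have : 1 / b = Real.pi / 2 * (1 / (1 + ρ)) := by rw [hb]; field_simp
    rw [this, Real.mul_rpow (by positivity) (by positivity), Real.div_rpow zero_le_one h1ρ.le,
      Real.one_rpow]
    ring
  calc
    angularIntegral k a ρ ≤ ∫⁻ θ in Ioo (0 : ℝ) (Real.pi / 2),
        ENNReal.ofReal (Real.exp 1) * ENNReal.ofReal (θ ^ (a - 1) * Real.exp (-(b * θ))) := by
      refine setLIntegral_mono' measurableSet_Ioo fun θ h ↦ ?_
      rw [← ENNReal.ofReal_mul (Real.exp_pos 1).le]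
      refine ENNReal.ofReal_le_ofReal ?_
      have h0 : 0 < θ := h.1
      have hs0 : 0 ≤ Real.sin θ := Real.sin_nonneg_of_nonneg_of_le_pi h0.le (by linarith [h.2])
      have hc0 : 0 ≤ Real.cos θ := Real.cos_nonneg_of_mem_Icc ⟨by linarith, h.2.le⟩
      have hck : Real.cos θ ^ k ≤ 1 := pow_le_one₀ hc0 (Real.cos_le_one θ)
      have hs : 2 / Real.pi * θ ≤ Real.sin θ := Real.mul_le_sin h0.le h.2.le
      have he : Real.exp (-(ρ * Real.sin θ)) ≤ Real.exp 1 * Real.exp (-(b * θ)) := by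
        rw [← Real.exp_add]
        refine Real.exp_le_exp.2 ?_
        have h1 : ρ * (2 / Real.pi * θ) ≤ ρ * Real.sin θ := by gcongr
        have h2 : 2 / Real.pi * θ ≤ 1 := hs.trans (Real.sin_le_one θ)
        rw [hb]
        linarith
      have hsa : Real.sin θ ^ (a - 1) ≤ θ ^ (a - 1) :=
        Real.rpow_le_rpow hs0 (Real.sin_le h0.le) (by linarith)
      calc _ ≤ 1 * ((Real.exp 1 * Real.exp (-(b * θ))) * θ ^ (a - 1)) := by gcongr
        _ = _ := by ring
    _ ≤ ∫⁻ θ in Ioi (0 : ℝ),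
        ENNReal.ofReal (Real.exp 1) * ENNReal.ofReal (θ ^ (a - 1) * Real.exp (-(b * θ))) :=
      lintegral_mono_set Ioo_subset_Ioi_self
    _ = _ := by
      rw [lintegral_const_mul' _ _ ENNReal.ofReal_ne_top,
        ← ofReal_integral_eq_lintegral_ofReal hintegrable, hint,
        ← ENNReal.ofReal_mul (Real.exp_pos 1).le, hval]
      filter_upwards [ae_restrict_mem measurableSet_Ioi] with t ht
      exact mul_nonneg (Real.rpow_nonneg (le_of_lt ht) _) (Real.exp_pos _).le

theorem measurable_FnmR (m : ℕ) (ν q R : ℝ) (μ : Measure (EuclideanSpace ℝ (Fin m)))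
    [IsFiniteMeasure μ] : Measurable (FnmR m ν q R μ) := by
  have h1 : Measurable fun p : (ℝ × EuclideanSpace ℝ (Fin m)) × EuclideanSpace ℝ (Fin m) ↦
      ENNReal.ofReal ((p.1.1 ^ 2 + ‖p.1.2 - p.2‖ ^ 2) ^ (-ν / 2)) := by fun_prop
  have h2 : Measurable fun p : ℝ × EuclideanSpace ℝ (Fin m) ↦ innerKernel m ν μ p.1 p.2 ^ q :=
    (h1.lintegral_prod_right' (ν := μ)).pow_const q
  exact h2.lintegral_prod_right'

/-- `I^{m,j}_{ν,σ}(μ; R)` as a weighted integral of `F^R_{ν,m}[μ]` over `(0, R)`. -/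
theorem ImjR_eq_lintegral_angularIntegral (m j : ℕ) (hj : 2 ≤ j) (ν σ q R : ℝ) (hR : 0 < R)
    (μ : Measure (EuclideanSpace ℝ (Fin m))) [IsFiniteMeasure μ] :
    ImjR m j ν σ q R μ =
      (volume : Measure (EuclideanSpace ℝ (Fin (j - 1)))).toSphere univ *
        ∫⁻ ρ in Ioo (0 : ℝ) R, FnmR m ν q R μ ρ *
          (ENNReal.ofReal (ρ ^ ((σ + 1) * q + j - 2)) *
            angularIntegral (j - 2) ((σ + 1) * q) ρ) := by
  set a := (σ + 1) * q
  have hF := measurable_FnmR m ν q R μ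
  have : Nonempty (Fin (j - 1)) := ⟨⟨0, by omega⟩⟩
  have : Nontrivial (EuclideanSpace ℝ (Fin (j - 1))) := inferInstance
  let g : ℝ → ℝ → ℝ≥0∞ := fun t r ↦ {p : ℝ × ℝ | p.1 ^ 2 + p.2 ^ 2 < R ^ 2}.indicator
    (fun p ↦ FnmR m ν q R μ (Real.sqrt (p.1 ^ 2 + p.2 ^ 2)) *
      ENNReal.ofReal (Real.exp (-p.1) * p.1 ^ (a - 1))) (t, r)
  have hD : MeasurableSet {p : ℝ × ℝ | p.1 ^ 2 + p.2 ^ 2 < R ^ 2} :=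
    measurableSet_lt (by fun_prop) (by fun_prop)
  have hg : Measurable (Function.uncurry g) :=
    Measurable.indicator ((hF.comp (by fun_prop)).mul (by fun_prop)) hD
  have hfin : Module.finrank ℝ (EuclideanSpace ℝ (Fin (j - 1))) - 1 = j - 2 := by
    rw [finrank_euclideanSpace_fin]; omega
  calc
    ImjR m j ν σ q R μ = ∫⁻ p : ℝ × EuclideanSpace ℝ (Fin (j - 1)) in {p | 0 < p.1},
        g p.1 ‖p.2‖ := by
      have hP : MeasurableSet {p : ℝ × EuclideanSpace ℝ (Fin (j - 1)) | 0 < p.1} :=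
        measurableSet_lt measurable_const measurable_fst
      have hPD : MeasurableSet {p : ℝ × EuclideanSpace ℝ (Fin (j - 1)) |
          0 < p.1 ∧ p.1 ^ 2 + ‖p.2‖ ^ 2 < R ^ 2} :=
        hP.inter (measurableSet_lt
          ((measurable_fst.pow_const 2).add (measurable_snd.norm.pow_const 2)) measurable_const)
      rw [ImjR, if_pos hj, ← lintegral_indicator hP, ← lintegral_indicator hPD]
      congr 1
      ext p
      by_cases h1 : 0 < p.1 <;> by_cases h2 : p.1 ^ 2 + ‖p.2‖ ^ 2 < R ^ 2 <;>
        simp [g, indicator, h1, h2, a]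
    _ = _ := by
      rw [setLIntegral_halfSpace_eq_polar hg, hfin]
      congr 1
      rw [← lintegral_indicator measurableSet_Ioi, ← lintegral_indicator measurableSet_Ioo]
      congr 1
      ext ρ
      by_cases hρ : 0 < ρ
      swap
      · rw [indicator_of_notMem (by simpa using hρ), indicator_of_notMem fun h ↦ hρ h.1]
      rw [indicator_of_mem (show ρ ∈ Ioi (0 : ℝ) from hρ)]
      have hnorm (θ : ℝ) : (ρ * Real.sin θ) ^ 2 + (ρ * Real.cos θ) ^ 2 = ρ ^ 2 := by
        rw [mul_pow, mul_pow, ← mul_add, Real.sin_sq_add_cos_sq, mul_one]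
      by_cases hρR : ρ < R
      · rw [indicator_of_mem (show ρ ∈ Ioo (0 : ℝ) R from ⟨hρ, hρR⟩), angularIntegral,
          ← lintegral_const_mul _ (by fun_prop), ← lintegral_const_mul _ (by fun_prop)]
        refine setLIntegral_congr_fun measurableSet_Ioo fun θ h ↦ ?_
        have hs : 0 < Real.sin θ :=
          Real.sin_pos_of_pos_of_lt_pi h.1 (by linarith [h.2, Real.pi_pos])
        have hc : 0 < Real.cos θ :=
          Real.cos_pos_of_mem_Ioo ⟨by linarith [h.1, Real.pi_pos], h.2⟩
        have hmem : ((ρ * Real.sin θ, ρ * Real.cos θ) : ℝ × ℝ) ∈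
            {p : ℝ × ℝ | p.1 ^ 2 + p.2 ^ 2 < R ^ 2} := by
          simp only [mem_ofPred_eq, hnorm]
          gcongr
        simp only [g]
        rw [indicator_of_mem hmem]
        simp only [hnorm, Real.sqrt_sq hρ.le]
        have hw : ρ * ((ρ * Real.cos θ) ^ (j - 2) *
            (Real.exp (-(ρ * Real.sin θ)) * (ρ * Real.sin θ) ^ (a - 1))) =
            ρ ^ (a + j - 2) * (Real.cos θ ^ (j - 2) *
              (Real.exp (-(ρ * Real.sin θ)) * Real.sin θ ^ (a - 1))) := by
          have e : ρ ^ (a + j - 2) = ρ * ρ ^ (j - 2) * ρ ^ (a - 1) := by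
            rw [← pow_succ', ← Real.rpow_natCast, ← Real.rpow_add hρ]
            congr 1
            push_cast [Nat.cast_sub hj]
            ring
          rw [e, mul_pow, Real.mul_rpow hρ.le hs.le]
          ring
        rw [← ENNReal.ofReal_mul (by positivity), ← hw, ENNReal.ofReal_mul hρ.le,
          ENNReal.ofReal_mul (by positivity : 0 ≤ (ρ * Real.cos θ) ^ (j - 2))]
        ring
      · rw [indicator_of_notMem fun h ↦ hρR h.2]
        have hnot (θ : ℝ) : ((ρ * Real.sin θ, ρ * Real.cos θ) : ℝ × ℝ) ∉
            {p : ℝ × ℝ | p.1 ^ 2 + p.2 ^ 2 < R ^ 2} := by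
          simp only [mem_ofPred_eq, hnorm, not_lt]
          gcongr
          exact not_lt.1 hρR
        simp [g, indicator_of_notMem (hnot _)]

/-- Lemma 3.4: two-sided comparison of `I^{m,j}_{ν,σ}(μ; R)` with
`∫₀^R F^R_{ν,m}[μ](τ) h_{σ,j}(τ) dτ`, with a constant independent of `R`,
for measures supported in the closed ball of radius `R`. -/
theorem lemma_3_4 (m j : ℕ) (hm : 1 ≤ m) (hj : 1 ≤ j) (ν σ q : ℝ)
    (hν : (m : ℝ) < ν) (hσ : 0 < σ) (hq : 1 < q) :
    ∃ c : ℝ, 0 < c ∧ ∀ R : ℝ, 0 < R →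
      ∀ μ : Measure (EuclideanSpace ℝ (Fin m)), IsFiniteMeasure μ →
        μ (Metric.closedBall (0 : EuclideanSpace ℝ (Fin m)) R)ᶜ = 0 →
      ENNReal.ofReal (1 / c) *
          (∫⁻ τ in Ioo (0 : ℝ) R, FnmR m ν q R μ τ * ENNReal.ofReal (hWeight σ q j τ)) ≤
        ImjR m j ν σ q R μ ∧
      ImjR m j ν σ q R μ ≤ ENNReal.ofReal c *
          (∫⁻ τ in Ioo (0 : ℝ) R, FnmR m ν q R μ τ * ENNReal.ofReal (hWeight σ q j τ)) := by
  rcases lt_or_ge j 2 with hj2 | hj2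
  · refine ⟨1, one_pos, fun R _ μ _ _ ↦ ?_⟩
    simp [ImjR, hWeight, not_le.2 hj2]
  have : Nonempty (Fin (j - 1)) := ⟨⟨0, by omega⟩⟩
  have : Nontrivial (EuclideanSpace ℝ (Fin (j - 1))) := inferInstance
  set a := (σ + 1) * q with ha_def
  have ha : 1 ≤ a := by nlinarith
  set S := (volume : Measure (EuclideanSpace ℝ (Fin (j - 1)))).toSphere univ with hS
  have hS0 : S ≠ 0 := by
    rw [hS, Measure.toSphere_apply_univ]
    exact mul_ne_zero (Nat.cast_ne_zero.2 Module.finrank_pos.ne')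
      (Metric.measure_ball_pos _ _ one_pos).ne'
  have hStop : S ≠ ∞ := measure_ne_top _ _
  set K := S.toReal
  have hK : 0 < K := ENNReal.toReal_pos hS0 hStop
  have hSK : S = ENNReal.ofReal K := (ENNReal.ofReal_toReal hStop).symm
  set A := Real.cos 1 ^ (j - 2) * (Real.exp (-1) * (1 / Real.pi) ^ (a - 1)) / 2
  have hA : 0 < A := by
    have := Real.cos_one_pos
    have := Real.pi_pos
    positivity
  set B := Real.exp 1 * ((Real.pi / 2) ^ a * Real.Gamma a)
  have hB : 0 < B := by
    have := Real.Gamma_pos_of_pos (by linarith : 0 < a)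
    have := Real.pi_pos
    positivity
  have hweight (ρ : ℝ) : hWeight σ q j ρ = ρ ^ (a + j - 2) * (1 / (1 + ρ) ^ a) := by
    rw [hWeight, if_pos hj2, ← ha_def, mul_one_div]
  refine ⟨max (1 / (K * A)) (K * B), by positivity, fun R hR μ _ _ ↦ ?_⟩
  rw [ImjR_eq_lintegral_angularIntegral m j hj2 ν σ q R hR μ, ← hS, hSK]
  constructor
  · calc
      _ ≤ ENNReal.ofReal (K * A) * ∫⁻ τ in Ioo (0 : ℝ) R,
          FnmR m ν q R μ τ * ENNReal.ofReal (hWeight σ q j τ) := by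
        gcongr
        rw [one_div_le (by positivity) (by positivity)]
        exact le_max_left _ _
      _ = ENNReal.ofReal K * ∫⁻ τ in Ioo (0 : ℝ) R, ENNReal.ofReal A *
          (FnmR m ν q R μ τ * ENNReal.ofReal (hWeight σ q j τ)) := by
        rw [lintegral_const_mul' _ _ ENNReal.ofReal_ne_top, ENNReal.ofReal_mul hK.le, mul_assoc]
      _ ≤ _ := by
        refine mul_le_mul_right ?_ _
        refine setLIntegral_mono' measurableSet_Ioo fun ρ h ↦ ?_
        rw [hweight, mul_left_comm, ← ENNReal.ofReal_mul hA.le, mul_left_comm,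
          ENNReal.ofReal_mul (Real.rpow_nonneg h.1.le _)]
        gcongr
        exact le_angularIntegral _ ha h.1.le
  · calc
      _ ≤ ENNReal.ofReal K * ∫⁻ τ in Ioo (0 : ℝ) R, ENNReal.ofReal B *
          (FnmR m ν q R μ τ * ENNReal.ofReal (hWeight σ q j τ)) := by
        refine mul_le_mul_right ?_ _
        refine setLIntegral_mono' measurableSet_Ioo fun ρ h ↦ ?_
        rw [hweight, mul_left_comm (ENNReal.ofReal B), ← ENNReal.ofReal_mul hB.le,
          mul_left_comm B, ENNReal.ofReal_mul (Real.rpow_nonneg h.1.le _)]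
        gcongr
        exact angularIntegral_le _ ha h.1.le
      _ = ENNReal.ofReal (K * B) * ∫⁻ τ in Ioo (0 : ℝ) R,
          FnmR m ν q R μ τ * ENNReal.ofReal (hWeight σ q j τ) := by
        rw [lintegral_const_mul' _ _ ENNReal.ofReal_ne_top, ENNReal.ofReal_mul hK.le, mul_assoc]
      _ ≤ _ := by
        gcongr
        exact le_max_right _ _
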